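/- arXiv:2104.10080 — 2 statements merged into one kernel-verified Lean document; each statement's English description precedes it below -/
import Mathlib

section
/- For positive integers m1, m2, the independence number of A_{m1,m2} is: (m1+m2+4)/2 if m1 and m2 are both odd; (m1+m2+3)/2 if m1 and m2 have different parity; and (m1+m2+2)/2 if m1 and m2 are both even. -/
open Polynomial SimpleGraph

/-- A finset of vertices is independent if no two of its vertices are adjacent. -/
def SimpleGraph.IsIndepFinset {V : Type*} (G : SimpleGraph V) (s : Finset V) : Prop :=
  ∀ v ∈ s, ∀ w ∈ s, ¬ G.Adj v w

open scoped Classical in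
/-- The independence polynomial `I(G,x) = Σ_k i_k(G) xᵏ` of a finite simple graph,
regarded as a polynomial with rational coefficients. -/
noncomputable def SimpleGraph.indepPoly {V : Type*} [Fintype V] (G : SimpleGraph V) :
    Polynomial ℚ :=
  ∑ s : Finset V, if G.IsIndepFinset s then (X : Polynomial ℚ) ^ s.card else 0

open scoped Classical in
/-- The independence number of a finite simple graph: the largest cardinality of a set
of pairwise non-adjacent vertices. -/
noncomputable def SimpleGraph.indepNumber {V : Type*} [Fintype V] (G : SimpleGraph V) : ℕ :=
  Finset.univ.sup fun s : Finset V => if G.IsIndepFinset s then s.card else 0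

/-- `Agraph m1 m2` : a triangle (on `m1`, `m1+1` and the apex `m1+m2+2`) with
vertex-disjoint pendant paths on `m1` vertices (`0,…,m1-1`) and on `m2` vertices
(`m1+2,…,m1+m2+1`) attached to the two triangle vertices `m1` and `m1+1`. -/
def Agraph (m1 m2 : ℕ) : SimpleGraph (Fin (m1 + m2 + 3)) :=
  SimpleGraph.fromRel (fun i j =>
    (i.val + 1 = j.val ∧ j.val ≤ m1 + m2 + 1) ∨
    (i.val = m1 ∧ j.val = m1 + m2 + 2) ∨
    (i.val = m1 + 1 ∧ j.val = m1 + m2 + 2))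

theorem Agraph_upper (m1 m2 : ℕ) (s : Finset (Fin (m1 + m2 + 3)))
    (hs : (Agraph m1 m2).IsIndepFinset s) : s.card ≤ (m1 + 1) / 2 + (m2 + 1) / 2 + 1 := by
  rw [← Finset.card_range ((m1 + 1) / 2 + (m2 + 1) / 2 + 1)]
  apply Finset.card_le_card_of_injOn (fun v : Fin (m1 + m2 + 3) =>
    if v.val < m1 then v.val / 2
    else if v.val = m1 ∨ v.val = m1 + 1 ∨ v.val = m1 + m2 + 2 then (m1 + 1) / 2
    else (m1 + 1) / 2 + 1 + (v.val - m1 - 2) / 2)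
  · intro v _
    have := v.isLt
    simp only [Finset.coe_range, Set.mem_Iio]
    split_ifs <;> omega
  · intro v hv w hw hvw
    have hadj := hs v hv w hw
    have h1 := v.isLt
    have h2 := w.isLt
    by_contra hne
    have hne' : v.val ≠ w.val := fun h => hne (Fin.ext h)
    apply hadj
    rw [Agraph, SimpleGraph.fromRel_adj]
    refine ⟨hne, ?_⟩
    simp only at hvw
    split_ifs at hvw <;> omega

theorem Agraph_lower (m1 m2 : ℕ) : ∃ s : Finset (Fin (m1 + m2 + 3)),
    (Agraph m1 m2).IsIndepFinset s ∧ s.card = (m1 + 1) / 2 + (m2 + 1) / 2 + 1 := by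
  let g : ℕ → ℕ := fun i =>
    if i < (m1 + 1) / 2 then 2 * i
    else if i = (m1 + 1) / 2 then m1 + m2 + 2
    else m1 + 2 + 2 * (i - (m1 + 1) / 2 - 1)
  have hg : ∀ i : Fin ((m1 + 1) / 2 + (m2 + 1) / 2 + 1), g i.val < m1 + m2 + 3 := by
    intro i
    have := i.isLt
    simp only [g]
    split_ifs <;> omega
  refine ⟨Finset.univ.image (fun i => (⟨g i.val, hg i⟩ : Fin (m1 + m2 + 3))), ?_, ?_⟩
  · intro v hv w hw
    simp only [Finset.mem_image, Finset.mem_univ, true_and] at hv hw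
    obtain ⟨i, rfl⟩ := hv
    obtain ⟨j, rfl⟩ := hw
    have h1 := i.isLt
    have h2 := j.isLt
    rw [Agraph, SimpleGraph.fromRel_adj]
    rintro ⟨-, h⟩
    simp only [g] at h
    split_ifs at h <;> omega
  · rw [Finset.card_image_of_injective, Finset.card_univ, Fintype.card_fin]
    intro i j hij
    have h1 := i.isLt
    have h2 := j.isLt
    simp only [g, Fin.mk.injEq] at hij
    apply Fin.ext
    split_ifs at hij <;> omega

theorem Agraph_indepNumber (m1 m2 : ℕ) :
    (Agraph m1 m2).indepNumber = (m1 + 1) / 2 + (m2 + 1) / 2 + 1 := by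
  classical
  unfold SimpleGraph.indepNumber
  apply le_antisymm
  · apply Finset.sup_le
    intro s _
    split_ifs with h
    · exact Agraph_upper m1 m2 s h
    · omega
  · obtain ⟨s, hs, hc⟩ := Agraph_lower m1 m2
    rw [← hc]
    refine le_trans ?_ (Finset.le_sup (Finset.mem_univ s))
    rw [if_pos hs]

/-- The independence number of `A_{m1,m2}`: `(m1+m2+4)/2` if `m1, m2` are both odd,
`(m1+m2+3)/2` if they have different parity, and `(m1+m2+2)/2` if both are even. -/
theorem indepNum_Agraph (m1 m2 : ℕ) (h1 : 1 ≤ m1) (h2 : 1 ≤ m2) :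
    (Odd m1 → Odd m2 → (Agraph m1 m2).indepNumber = (m1 + m2 + 4) / 2) ∧
    (¬ (Odd m1 ↔ Odd m2) → (Agraph m1 m2).indepNumber = (m1 + m2 + 3) / 2) ∧
    (Even m1 → Even m2 → (Agraph m1 m2).indepNumber = (m1 + m2 + 2) / 2) := by
  rw [Agraph_indepNumber]
  simp only [Nat.odd_iff, Nat.even_iff]
  refine ⟨?_, ?_, ?_⟩ <;> intros <;> omega
end

section
/- For integers m1 ≥ 0 and m2, m3 ≥ 1, the independence number of B_{m1,m2,m3} is: (m1+m2+m3+5)/2 if m1, m2, m3 are all odd; (m1+m2+m3+4)/2 if either none or exactly two of m1, m2, m3 are odd; and (m1+m2+m3+3)/2 if exactly one of m1, m2, m3 is odd. -/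
open Polynomial SimpleGraph

/-- `Bgraph m1 m2 m3` : a triangle `0,1,2`, a path `3,…,m1+2` ending in the vertex
`v = m1+3`, with `3` joined to the triangle vertex `2` (if `m1 = 0` then `v` is joined
directly to `2`), and two vertex-disjoint pendant paths on `m2` vertices
(`m1+4,…,m1+m2+3`) and on `m3` vertices (`m1+m2+4,…,m1+m2+m3+3`) attached to `v`. -/
def Bgraph (m1 m2 m3 : ℕ) : SimpleGraph (Fin (m1 + m2 + m3 + 4)) :=
  SimpleGraph.fromRel (fun i j =>
    (i.val + 1 = j.val ∧ j.val ≤ m1 + 3) ∨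
    (i.val = 0 ∧ j.val = 2) ∨
    (i.val + 1 = j.val ∧ m1 + 4 ≤ i.val ∧ j.val ≤ m1 + m2 + 3) ∨
    (i.val = m1 + 3 ∧ j.val = m1 + 4) ∨
    (i.val + 1 = j.val ∧ m1 + m2 + 4 ≤ i.val) ∨
    (i.val = m1 + 3 ∧ j.val = m1 + m2 + 4))

/-- The finset `{a, a+2, …, a+2(c-1)}`. -/
def altSet (a c : ℕ) : Finset ℕ := (Finset.range c).image (fun i => a + 2 * i)

theorem mem_altSet {a c x : ℕ} : x ∈ altSet a c ↔ ∃ i < c, a + 2 * i = x := by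
  simp [altSet]

theorem card_altSet (a c : ℕ) : (altSet a c).card = c := by
  unfold altSet
  rw [Finset.card_image_of_injective _ (fun i j h => by simpa using h), Finset.card_range]

/-- A set of naturals in an interval of length `m` with no two consecutive elements. -/
theorem card_le_of_no_consec (m : ℕ) : ∀ (a : ℕ) (T : Finset ℕ),
    (∀ x ∈ T, a ≤ x ∧ x < a + m) → (∀ x ∈ T, x + 1 ∉ T) → T.card ≤ (m + 1) / 2 := by
  induction m using Nat.strong_induction_on with
  | _ m ih =>
    intro a T hT hc
    rcases Nat.lt_or_ge m 2 with hm | hm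
    · have hs : T ⊆ Finset.Ico a (a + m) := fun x hx => Finset.mem_Ico.2 (hT x hx)
      have := Finset.card_le_card hs
      rw [Nat.card_Ico] at this
      omega
    · have h1 := ih (m - 2) (by omega) (a + 2) (T.filter (fun x => a + 2 ≤ x))
        (fun x hx => by
          have := Finset.mem_filter.1 hx
          have := hT x this.1
          omega)
        (fun x hx hx' => hc x (Finset.mem_filter.1 hx).1 (Finset.mem_filter.1 hx').1)
      have h2 : (T.filter (fun x => ¬ a + 2 ≤ x)).card ≤ 1 := by
        rw [Finset.card_le_one]
        intro x hx y hy
        have hx := Finset.mem_filter.1 hx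
        have hy := Finset.mem_filter.1 hy
        have bx := hT x hx.1
        have bY := hT y hy.1
        by_contra hne
        rcases Nat.lt_or_gt_of_ne hne with h | h
        · have : x + 1 = y := by omega
          exact hc x hx.1 (this ▸ hy.1)
        · have : y + 1 = x := by omega
          exact hc y hy.1 (this ▸ hx.1)
      have h3 := Finset.card_filter_add_card_filter_not (s := T) (fun x => a + 2 ≤ x)
      omega

theorem card_split (S : Finset ℕ) (b : ℕ) :
    S.card = (S.filter (fun x => x < b)).card + (S.filter (fun x => b ≤ x)).card := by
  have h3 := Finset.card_filter_add_card_filter_not (s := S) (fun x => x < b)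
  simp only [not_lt] at h3
  omega

/-- The part of `S` in `[a, b)`. -/
def part (S : Finset ℕ) (a b : ℕ) : Finset ℕ := S.filter (fun x => a ≤ x ∧ x < b)

theorem mem_part {S : Finset ℕ} {a b x : ℕ} : x ∈ part S a b ↔ x ∈ S ∧ a ≤ x ∧ x < b := by
  simp [part]

theorem card_part_add (S : Finset ℕ) {a b c : ℕ} (h1 : a ≤ b) (h2 : b ≤ c) :
    (part S a c).card = (part S a b).card + (part S b c).card := by
  rw [card_split (part S a c) b]
  have e1 : (part S a c).filter (fun x => x < b) = part S a b := by
    ext x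
    simp only [Finset.mem_filter, mem_part]
    exact ⟨fun h => ⟨h.1.1, by omega⟩, fun h => ⟨⟨h.1, by omega⟩, by omega⟩⟩
  have e2 : (part S a c).filter (fun x => b ≤ x) = part S b c := by
    ext x
    simp only [Finset.mem_filter, mem_part]
    exact ⟨fun h => ⟨h.1.1, by omega⟩, fun h => ⟨⟨h.1, by omega⟩, by omega⟩⟩
  rw [e1, e2]

theorem card_part_le (S : Finset ℕ) (a b : ℕ) (h : ∀ x ∈ S, a ≤ x → x + 1 < b → x + 1 ∉ S) :
    (part S a b).card ≤ (b - a + 1) / 2 := by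
  apply card_le_of_no_consec (b - a) a
  · intro x hx
    have := mem_part.1 hx
    omega
  · intro x hx hx'
    have h1 := mem_part.1 hx
    have h2 := mem_part.1 hx'
    exact h x h1.1 h1.2.1 h2.2.2 h2.1

theorem card_part_one (S : Finset ℕ) (a : ℕ) (h : a ∉ S) : (part S a (a+1)).card = 0 := by
  rw [Finset.card_eq_zero, Finset.eq_empty_iff_forall_notMem]
  intro x hx
  have h1 := mem_part.1 hx
  have : x = a := by omega
  exact h (this ▸ h1.1)

/-- The edge relation on naturals. -/
def bRel (m1 m2 i j : ℕ) : Prop :=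
    (i + 1 = j ∧ j ≤ m1 + 3) ∨
    (i = 0 ∧ j = 2) ∨
    (i + 1 = j ∧ m1 + 4 ≤ i ∧ j ≤ m1 + m2 + 3) ∨
    (i = m1 + 3 ∧ j = m1 + 4) ∨
    (i + 1 = j ∧ m1 + m2 + 4 ≤ i) ∨
    (i = m1 + 3 ∧ j = m1 + m2 + 4)

theorem indep_iff (m1 m2 m3 : ℕ) (s : Finset (Fin (m1 + m2 + m3 + 4))) :
    (Bgraph m1 m2 m3).IsIndepFinset s ↔
      ∀ i ∈ s, ∀ j ∈ s, ¬ bRel m1 m2 i.val j.val := by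
  unfold SimpleGraph.IsIndepFinset
  constructor
  · intro h i hi j hj hr
    refine h i hi j hj ?_
    rw [Bgraph, SimpleGraph.fromRel_adj]
    refine ⟨?_, Or.inl hr⟩
    rintro rfl
    unfold bRel at hr
    omega
  · intro h i hi j hj hr
    rw [Bgraph, SimpleGraph.fromRel_adj] at hr
    rcases hr.2 with hr | hr
    · exact h i hi j hj hr
    · exact h j hj i hi hr

set_option maxHeartbeats 2000000 in
theorem lower (m1 m2 m3 a e c2 c3 : ℕ) (he : e ≤ 1) (ha : 2 * a + e ≤ m1 + 1)
    (hc2 : 2 * c2 + e ≤ m2 + 1) (hc3 : 2 * c3 + e ≤ m3 + 1) :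
    1 + a + e + c2 + c3 ≤ (Bgraph m1 m2 m3).indepNumber := by
  classical
  set T : Finset ℕ := altSet 0 1 ∪ altSet 3 a ∪ altSet (m1+3) e ∪ altSet (m1+4+e) c2 ∪
    altSet (m1+m2+4+e) c3 with hT
  have mem : ∀ x, x ∈ T ↔ (x = 0 ∨ (∃ i < a, 3 + 2 * i = x) ∨ (e = 1 ∧ x = m1 + 3) ∨
      (∃ i < c2, m1 + 4 + e + 2 * i = x) ∨ (∃ i < c3, m1 + m2 + 4 + e + 2 * i = x)) := by
    intro x
    have h1 : (∃ i < e, m1 + 3 + 2 * i = x) ↔ (e = 1 ∧ x = m1 + 3) := by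
      constructor
      · rintro ⟨i, hi, rfl⟩
        omega
      · rintro ⟨rfl, rfl⟩
        exact ⟨0, by omega, by omega⟩
    have h0 : (∃ i < 1, 0 + 2 * i = x) ↔ x = 0 := by
      constructor
      · rintro ⟨i, hi, rfl⟩
        omega
      · rintro rfl
        exact ⟨0, by omega, by omega⟩
    simp only [hT, Finset.mem_union, mem_altSet, h1, h0, or_assoc]
  have hb : ∀ x ∈ T, x < m1 + m2 + m3 + 4 := by
    intro x hx
    rcases (mem x).1 hx with h | ⟨i, hi, h⟩ | h | ⟨i, hi, h⟩ | ⟨i, hi, h⟩ <;> omega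
  have hcard : T.card = 1 + a + e + c2 + c3 := by
    rw [hT, Finset.card_union_of_disjoint, Finset.card_union_of_disjoint,
      Finset.card_union_of_disjoint, Finset.card_union_of_disjoint]
    · simp only [card_altSet]
    all_goals
      rw [Finset.disjoint_left]
      intro x hx hx'
      simp only [Finset.mem_union, mem_altSet] at hx hx'
      obtain ⟨j, hj, h'⟩ := hx'
    · rcases hx with ⟨i, hi, h⟩
      omega
    · rcases hx with ⟨i, hi, h⟩ | ⟨i, hi, h⟩ <;> omega
    · rcases hx with (⟨i, hi, h⟩ | ⟨i, hi, h⟩) | ⟨i, hi, h⟩ <;> omega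
    · rcases hx with ((⟨i, hi, h⟩ | ⟨i, hi, h⟩) | ⟨i, hi, h⟩) | ⟨i, hi, h⟩ <;> omega
  have hind : (Bgraph m1 m2 m3).IsIndepFinset (T.attachFin hb) := by
    rw [indep_iff]
    intro i hi j hj hr
    rw [Finset.mem_attachFin, mem] at hi hj
    unfold bRel at hr
    rcases hi with h | ⟨p, hp, h⟩ | h | ⟨p, hp, h⟩ | ⟨p, hp, h⟩ <;>
    rcases hj with h' | ⟨q, hq, h'⟩ | h' | ⟨q, hq, h'⟩ | ⟨q, hq, h'⟩ <;> omega
  have := Finset.le_sup (f := fun s : Finset (Fin (m1 + m2 + m3 + 4)) =>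
    if (Bgraph m1 m2 m3).IsIndepFinset s then s.card else 0) (Finset.mem_univ (T.attachFin hb))
  simp only [hind, if_true, Finset.card_attachFin, hcard] at this
  unfold SimpleGraph.indepNumber
  convert this

set_option maxHeartbeats 2000000 in
theorem upper (m1 m2 m3 N : ℕ) (h2 : 1 ≤ m2) (h3 : 1 ≤ m3)
    (hN1 : 1 + (m1 + 1) / 2 + (m2 + 1) / 2 + (m3 + 1) / 2 ≤ N)
    (hN2 : 2 + m1 / 2 + m2 / 2 + m3 / 2 ≤ N) :
    (Bgraph m1 m2 m3).indepNumber ≤ N := by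
  classical
  unfold SimpleGraph.indepNumber
  apply Finset.sup_le
  intro s _
  split_ifs with hs
  swap
  · exact Nat.zero_le _
  rw [indep_iff] at hs
  set S : Finset ℕ := s.map Fin.valEmbedding with hS
  have hmem : ∀ x, x ∈ S ↔ ∃ i ∈ s, i.val = x := by
    intro x
    simp [hS]
  have hr : ∀ x ∈ S, ∀ y ∈ S, ¬ bRel m1 m2 x y := by
    intro x hx y hy
    obtain ⟨i, hi, rfl⟩ := (hmem x).1 hx
    obtain ⟨j, hj, rfl⟩ := (hmem y).1 hy
    exact hs i hi j hj
  have hc : s.card = (part S 0 (m1+m2+m3+4)).card := by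
    rw [← Finset.card_map Fin.valEmbedding, ← hS]
    congr 1
    ext x
    rw [mem_part]
    refine ⟨fun h => ⟨h, Nat.zero_le _, ?_⟩, fun h => h.1⟩
    obtain ⟨i, hi, rfl⟩ := (hmem x).1 h
    exact i.2
  rw [card_part_add S (b := 3) (by omega) (by omega),
    card_part_add S (a := 3) (b := m1 + 3) (by omega) (by omega),
    card_part_add S (a := m1 + 3) (b := m1 + 3 + 1) (by omega) (by omega),
    card_part_add S (a := m1 + 3 + 1) (b := m1 + m2 + 4) (by omega) (by omega)] at hc
  have t0 : (part S 0 3).card ≤ 1 := by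
    rw [Finset.card_le_one]
    intro x hx y hy
    rw [mem_part] at hx hy
    have h1 := hr x hx.1 y hy.1
    have h2 := hr y hy.1 x hx.1
    unfold bRel at h1 h2
    omega
  have bd : ∀ a b, (∀ x, a ≤ x → x + 1 < b → bRel m1 m2 x (x+1)) →
      (part S a b).card ≤ (b - a + 1) / 2 := fun a b h =>
    card_part_le S a b (fun x hx h1 h2 h3 => hr x hx _ h3 (h x h1 h2))
  by_cases hv : m1 + 3 ∈ S
  · have e1 : (part S (m1+3) (m1+3+1)).card ≤ (m1 + 3 + 1 - (m1 + 3) + 1) / 2 :=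
      bd _ _ (fun x _ _ => by unfold bRel; omega)
    have e2 : (part S 3 (m1 + 3)).card ≤ m1 / 2 := by
      rcases Nat.eq_zero_or_pos m1 with h0 | h0
      · have := bd 3 (m1+3) (fun x _ _ => by unfold bRel; omega)
        omega
      · rw [card_part_add S (b := m1 + 2) (by omega) (by omega)]
        have := bd 3 (m1+2) (fun x _ _ => by unfold bRel; omega)
        have : (part S (m1+2) (m1+3)).card = 0 := card_part_one S (m1+2) (fun h => hr _ h _ hv (by unfold bRel; omega))
        omega
    have e3 : (part S (m1 + 3 + 1) (m1 + m2 + 4)).card ≤ m2 / 2 := by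
      rw [card_part_add S (b := m1 + 3 + 1 + 1) (by omega) (by omega)]
      have := bd (m1+3+1+1) (m1+m2+4) (fun x _ _ => by unfold bRel; omega)
      have := card_part_one S (m1+3+1) (fun h => hr _ hv _ h (by unfold bRel; omega))
      omega
    have e4 : (part S (m1 + m2 + 4) (m1 + m2 + m3 + 4)).card ≤ m3 / 2 := by
      rw [card_part_add S (b := m1 + m2 + 4 + 1) (by omega) (by omega)]
      have := bd (m1+m2+4+1) (m1+m2+m3+4) (fun x _ _ => by unfold bRel; omega)
      have := card_part_one S (m1+m2+4) (fun h => hr _ hv _ h (by unfold bRel; omega))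
      omega
    omega
  · have e1 := card_part_one S _ hv
    have e2 := bd 3 (m1+3) (fun x _ _ => by unfold bRel; omega)
    have e3 := bd (m1+3+1) (m1+m2+4) (fun x _ _ => by unfold bRel; omega)
    have e4 := bd (m1+m2+4) (m1+m2+m3+4) (fun x _ _ => by unfold bRel; omega)
    omega

/-- The independence number of `B_{m1,m2,m3}`: with `k` the number of odd values among
`m1, m2, m3`, it is `(m1+m2+m3+5)/2` if `k = 3`, `(m1+m2+m3+4)/2` if `k = 0` or `k = 2`,
and `(m1+m2+m3+3)/2` if `k = 1`. -/
theorem indepNum_Bgraph (m1 m2 m3 : ℕ) (h2 : 1 ≤ m2) (h3 : 1 ≤ m3) :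
    letI k : ℕ := (if Odd m1 then 1 else 0) + (if Odd m2 then 1 else 0) +
      (if Odd m3 then 1 else 0)
    (k = 3 → (Bgraph m1 m2 m3).indepNumber = (m1 + m2 + m3 + 5) / 2) ∧
    (k = 0 ∨ k = 2 → (Bgraph m1 m2 m3).indepNumber = (m1 + m2 + m3 + 4) / 2) ∧
    (k = 1 → (Bgraph m1 m2 m3).indepNumber = (m1 + m2 + m3 + 3) / 2) := by
  have hl1 := lower m1 m2 m3 ((m1+1)/2) 0 ((m2+1)/2) ((m3+1)/2) (by omega) (by omega) (by omega)
    (by omega)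
  have hl2 := lower m1 m2 m3 (m1/2) 1 (m2/2) (m3/2) (by omega) (by omega) (by omega) (by omega)
  have hu := upper m1 m2 m3 (max (1 + (m1 + 1) / 2 + (m2 + 1) / 2 + (m3 + 1) / 2)
    (2 + m1 / 2 + m2 / 2 + m3 / 2)) h2 h3 (le_max_left _ _) (le_max_right _ _)
  generalize (Bgraph m1 m2 m3).indepNumber = A at hl1 hl2 hu ⊢
  rw [le_max_iff] at hu
  simp only [Nat.odd_iff]
  have d1 := Nat.div_add_mod m1 2
  have d2 := Nat.div_add_mod m2 2
  have d3 := Nat.div_add_mod m3 2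
  have q1 : (m1 + 1) / 2 = m1 / 2 + m1 % 2 := by omega
  have q2 : (m2 + 1) / 2 = m2 / 2 + m2 % 2 := by omega
  have q3 : (m3 + 1) / 2 = m3 / 2 + m3 % 2 := by omega
  rw [q1, q2, q3] at hl1 hu
  have b1 := Nat.mod_two_eq_zero_or_one m1
  have b2 := Nat.mod_two_eq_zero_or_one m2
  have b3 := Nat.mod_two_eq_zero_or_one m3
  clear q1 q2 q3
  generalize m1 / 2 = x1 at *
  generalize m2 / 2 = x2 at *
  generalize m3 / 2 = x3 at *
  generalize m1 % 2 = y1 at *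
  generalize m2 % 2 = y2 at *
  generalize m3 % 2 = y3 at *
  rcases b1 with rfl | rfl <;> rcases b2 with rfl | rfl <;> rcases b3 with rfl | rfl <;>
    simp <;> omega
end
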